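/- arXiv:2505.13549 — 3 statements merged into one kernel-verified Lean document; each statement's English description precedes it below -/
import Mathlib

section
/- Let (S, A, P, r, γ) be a finite Markov decision process with 0 < γ < 1, let V* denote its optimal value function, and let V̂ : S → ℝ satisfy max_{s ∈ S} |V*(s) − V̂(s)| ≤ ε_v for some ε_v ≥ 0. Let π_V̂ be any deterministic policy that is 1-step greedy with respect to V̂, i.e., for every state s the action π_V̂(s) maximizes a ↦ r(s,a) + γ · Σ_{s'} P(s'|s,a) · V̂(s') over A. Then ((1 − γ)/(2γ)) · max_{s ∈ S} |V*(s) − V^{π_V̂}(s)| ≤ ε_v, where V^{π_V̂} is the value function of π_V̂. -/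
/-- **Singh–Yee bound for the 1-step greedy policy.**
If `max_s |V*(s) − V̂(s)| ≤ ε_v` and `π` is 1-step greedy with respect to `V̂`,
then `((1 − γ)/(2γ)) · max_s |V*(s) − V^π(s)| ≤ ε_v`. -/
theorem singh_yee_one_step_greedy
    {S A : Type*} [Fintype S] [Nonempty S] [Fintype A] [Nonempty A]
    -- transition kernel
    (P : S → A → S → ℝ)
    (hPnonneg : ∀ s a s', 0 ≤ P s a s')
    (hPsum : ∀ s a, ∑ s', P s a s' = 1)
    -- reward and discount
    (r : S → A → ℝ) (γ : ℝ) (hγ0 : 0 < γ) (hγ1 : γ < 1)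
    -- optimal value function
    (Vstar : S → ℝ)
    (hVstar : ∀ s, Vstar s = ⨆ a, (r s a + γ * ∑ s', P s a s' * Vstar s'))
    -- approximate value function
    (Vhat : S → ℝ) (εv : ℝ) (hεv : 0 ≤ εv)
    (hclose : ∀ s, |Vstar s - Vhat s| ≤ εv)
    -- 1-step greedy deterministic policy w.r.t. V̂
    (π : S → A)
    (hgreedy : ∀ s a, r s a + γ * ∑ s', P s a s' * Vhat s'
        ≤ r s (π s) + γ * ∑ s', P s (π s) s' * Vhat s')
    -- value function of the greedy policy
    (Vπ : S → ℝ)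
    (hVπ : ∀ s, Vπ s = r s (π s) + γ * ∑ s', P s (π s) s' * Vπ s') :
    (1 - γ) / (2 * γ) * (⨆ s, |Vstar s - Vπ s|) ≤ εv := by
  have avg : ∀ s a (f g : S → ℝ) (c : ℝ), (∀ s', f s' ≤ g s' + c) →
      γ * ∑ s', P s a s' * f s' ≤ γ * ∑ s', P s a s' * g s' + γ * c := by
    intro s a f g c h
    have h1 : ∑ s', P s a s' * f s' ≤ ∑ s', P s a s' * (g s' + c) :=
      Finset.sum_le_sum fun s' _ => mul_le_mul_of_nonneg_left (h s') (hPnonneg s a s')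
    simp only [mul_add, Finset.sum_add_distrib] at h1
    rw [← Finset.sum_mul, hPsum, one_mul] at h1
    rw [← mul_add]
    exact mul_le_mul_of_nonneg_left h1 hγ0.le
  have hM : ∀ s, |Vstar s - Vπ s| ≤ ⨆ s, |Vstar s - Vπ s| :=
    fun s => le_ciSup (f := fun s => |Vstar s - Vπ s|) (Set.finite_range _).bddAbove s
  set M := ⨆ s, |Vstar s - Vπ s| with hMdef
  have key : M ≤ 2 * γ * εv + γ * M := by
    rw [hMdef]
    apply ciSup_le
    intro s
    rw [← hMdef]
    have hc1 : ∀ s', Vstar s' ≤ Vhat s' + εv := fun s' => by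
      linarith [(abs_le.mp (hclose s')).2]
    have hc2 : ∀ s', Vhat s' ≤ Vstar s' + εv := fun s' => by
      linarith [(abs_le.mp (hclose s')).1]
    have hm1 : ∀ s', Vstar s' ≤ Vπ s' + M := fun s' => by
      linarith [(abs_le.mp (hM s')).2]
    have hm2 : ∀ s', Vπ s' ≤ Vstar s' + M := fun s' => by
      linarith [(abs_le.mp (hM s')).1]
    have a2 := avg s (π s) _ _ _ hc2
    have a3 := avg s (π s) _ _ _ hm1
    have a4 := avg s (π s) _ _ _ hm2
    have hup : Vstar s ≤ r s (π s) + γ * ∑ s', P s (π s) s' * Vhat s' + γ * εv := by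
      rw [hVstar s]
      apply ciSup_le
      intro a
      linarith [avg s a _ _ _ hc1, hgreedy s a]
    have hlo : r s (π s) + γ * ∑ s', P s (π s) s' * Vstar s' ≤ Vstar s := by
      rw [hVstar s]
      exact le_ciSup (f := fun a => r s a + γ * ∑ s', P s a s' * Vstar s')
        (Set.finite_range _).bddAbove (π s)
    have hp := hVπ s
    have := mul_nonneg hγ0.le hεv
    rw [abs_le]
    constructor <;> linarith
  rw [div_mul_eq_mul_div, div_le_iff₀ (by positivity)]
  linarith
end

section
/- Let (S, A, P, r, γ) be a finite Markov decision process with 0 < γ < 1 and suppose the rewards satisfy 0 ≤ r(s,a) ≤ R_max for all (s,a), with R_max > 0. Let ρ be a probability mass function on S (the initial state distribution) and for a policy π define the performance J^π = Σ_s ρ(s) · V^π(s). Then for any two policies π and π', ((1 − γ)² / (2 R_max)) · |J^π − J^{π'}| ≤ max_{s ∈ S} D_TV(π'(·|s), π(·|s)), where D_TV(μ, ν) = (1/2) · Σ_a |μ(a) − ν(a)| is the total variation distance between probability mass functions on A. -/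
theorem avg_abs_le {X : Type*} [Fintype X] (w f : X → ℝ) (C : ℝ) (hw : ∀ x, 0 ≤ w x)
    (hs : ∑ x, w x = 1) (hf : ∀ x, |f x| ≤ C) : |∑ x, w x * f x| ≤ C := by
  calc |∑ x, w x * f x| ≤ ∑ x, |w x * f x| := Finset.abs_sum_le_sum_abs _ _
    _ ≤ ∑ x, w x * C := by
        apply Finset.sum_le_sum
        intro x _
        rw [abs_mul, abs_of_nonneg (hw x)]
        exact mul_le_mul_of_nonneg_left (hf x) (hw x)
    _ = C := by rw [← Finset.sum_mul, hs, one_mul]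

/-- **Performance-difference lower bound via policy total-variation distance.**
For an MDP with rewards in `[0, R_max]` and performance `J^π = Σ_s ρ(s) V^π(s)`,
`((1 − γ)² / (2 R_max)) · |J^π − J^{π'}| ≤ max_s D_TV(π'(·|s), π(·|s))`. -/
theorem performance_gap_le_tv
    {S A : Type*} [Fintype S] [Nonempty S] [Fintype A] [Nonempty A]
    -- transition kernel
    (P : S → A → S → ℝ)
    (hPnonneg : ∀ s a s', 0 ≤ P s a s')
    (hPsum : ∀ s a, ∑ s', P s a s' = 1)
    -- reward and discount
    (r : S → A → ℝ) (γ : ℝ) (hγ0 : 0 < γ) (hγ1 : γ < 1)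
    (Rmax : ℝ) (hRmax : 0 < Rmax)
    (hr : ∀ s a, 0 ≤ r s a ∧ r s a ≤ Rmax)
    -- initial state distribution
    (ρ : S → ℝ) (hρnonneg : ∀ s, 0 ≤ ρ s) (hρsum : ∑ s, ρ s = 1)
    -- two stochastic policies
    (π π' : S → A → ℝ)
    (hπnonneg : ∀ s a, 0 ≤ π s a) (hπsum : ∀ s, ∑ a, π s a = 1)
    (hπ'nonneg : ∀ s a, 0 ≤ π' s a) (hπ'sum : ∀ s, ∑ a, π' s a = 1)
    -- their value functions (Bellman equations)
    (Vπ Vπ' : S → ℝ)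
    (hVπ : ∀ s, Vπ s = ∑ a, π s a * (r s a + γ * ∑ s', P s a s' * Vπ s'))
    (hVπ' : ∀ s, Vπ' s = ∑ a, π' s a * (r s a + γ * ∑ s', P s a s' * Vπ' s')) :
    (1 - γ) ^ 2 / (2 * Rmax) * |(∑ s, ρ s * Vπ s) - (∑ s, ρ s * Vπ' s)|
      ≤ ⨆ s, (1 / 2) * ∑ a, |π' s a - π s a| := by
  set T : ℝ := ⨆ s, (1 / 2) * ∑ a, |π' s a - π s a| with hT
  have hg : 0 < 1 - γ := by linarith
  have hTs : ∀ s, ∑ a, |π s a - π' s a| ≤ 2 * T := by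
    intro s
    have h := le_ciSup (f := fun s => (1 / 2 : ℝ) * ∑ a, |π' s a - π s a|)
      (Set.finite_range _).bddAbove s
    simp only [abs_sub_comm (π' _ _)] at h
    simp only [abs_sub_comm (π' _ _)] at hT
    rw [← hT] at h
    linarith
  -- bound on the value function
  obtain ⟨s0, hs0⟩ := Finite.exists_max (fun s => |Vπ s|)
  have hQ0 : ∀ s a, |r s a + γ * ∑ s', P s a s' * Vπ s'| ≤ Rmax + γ * |Vπ s0| := by
    intro s a
    have h1 := avg_abs_le (P s a) Vπ _ (hPnonneg s a) (hPsum s a) hs0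
    refine (abs_add_le _ _).trans ?_
    rw [abs_mul, abs_of_pos hγ0, abs_of_nonneg (hr s a).1]
    exact add_le_add (hr s a).2 (mul_le_mul_of_nonneg_left h1 hγ0.le)
  have hM : |Vπ s0| ≤ Rmax + γ * |Vπ s0| := by
    have h := avg_abs_le (π s0) _ _ (hπnonneg s0) (hπsum s0) (hQ0 s0)
    rwa [← hVπ s0] at h
  obtain ⟨M, hMdef⟩ : ∃ M, M = Rmax + γ * |Vπ s0| := ⟨_, rfl⟩
  rw [← hMdef] at hM
  simp only [← hMdef] at hQ0
  have hM2 : (1 - γ) * M ≤ Rmax := by nlinarith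
  have hM0 : 0 ≤ M := (abs_nonneg _).trans hM
  -- difference
  obtain ⟨s1, hs1⟩ := Finite.exists_max (fun s => |Vπ s - Vπ' s|)
  have hT0 : 0 ≤ T := by
    have := hTs s1
    have h2 : 0 ≤ ∑ a, |π s1 a - π' s1 a| := Finset.sum_nonneg fun _ _ => abs_nonneg _
    linarith
  have hdec : Vπ s1 - Vπ' s1 =
      ∑ a, (π s1 a - π' s1 a) * (r s1 a + γ * ∑ s', P s1 a s' * Vπ s')
      + γ * ∑ a, π' s1 a * ∑ s', P s1 a s' * (Vπ s' - Vπ' s') := by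
    rw [hVπ s1, hVπ' s1, Finset.mul_sum, ← Finset.sum_sub_distrib, ← Finset.sum_add_distrib]
    apply Finset.sum_congr rfl
    intro a _
    simp only [mul_sub, Finset.sum_sub_distrib]
    ring
  have hA : |∑ a, (π s1 a - π' s1 a) * (r s1 a + γ * ∑ s', P s1 a s' * Vπ s')| ≤ 2 * T * M := by
    refine (Finset.abs_sum_le_sum_abs _ _).trans ?_
    calc _ ≤ ∑ a, |π s1 a - π' s1 a| * M := by
          apply Finset.sum_le_sum
          intro a _
          rw [abs_mul]
          exact mul_le_mul_of_nonneg_left (hQ0 s1 a) (abs_nonneg _)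
      _ ≤ _ := by
          rw [← Finset.sum_mul]
          exact mul_le_mul_of_nonneg_right (hTs s1) hM0
  have hB := avg_abs_le (π' s1) (fun a => ∑ s', P s1 a s' * (Vπ s' - Vπ' s')) _
    (hπ'nonneg s1) (hπ'sum s1)
    (fun a => avg_abs_le (P s1 a) _ _ (hPnonneg s1 a) (hPsum s1 a) hs1)
  have hD : |Vπ s1 - Vπ' s1| ≤ 2 * T * M + γ * |Vπ s1 - Vπ' s1| := by
    conv_lhs => rw [hdec]
    refine (abs_add_le _ _).trans (add_le_add hA ?_)
    rw [abs_mul, abs_of_pos hγ0]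
    exact mul_le_mul_of_nonneg_left hB hγ0.le
  have hJ : |(∑ s, ρ s * Vπ s) - (∑ s, ρ s * Vπ' s)| ≤ |Vπ s1 - Vπ' s1| := by
    have h := avg_abs_le ρ _ _ hρnonneg hρsum hs1
    simpa only [mul_sub, Finset.sum_sub_distrib] using h
  rw [div_mul_eq_mul_div, div_le_iff₀ (by positivity)]
  calc (1 - γ) ^ 2 * |(∑ s, ρ s * Vπ s) - (∑ s, ρ s * Vπ' s)|
      ≤ (1 - γ) ^ 2 * |Vπ s1 - Vπ' s1| := mul_le_mul_of_nonneg_left hJ (sq_nonneg _)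
    _ = (1 - γ) * ((1 - γ) * |Vπ s1 - Vπ' s1|) := by ring
    _ ≤ (1 - γ) * (2 * T * M) := mul_le_mul_of_nonneg_left (by linarith) hg.le
    _ = 2 * T * ((1 - γ) * M) := by ring
    _ ≤ 2 * T * Rmax := mul_le_mul_of_nonneg_left hM2 (by linarith)
    _ = T * (2 * Rmax) := by ring
end

section
/- Let S and A be nonempty finite sets, let P and P̂ be two transition kernels assigning to each (s,a) ∈ S × A probability mass functions P(·|s,a) and P̂(·|s,a) on S, let r : S × A → ℝ satisfy 0 ≤ r(s,a) ≤ R_max, let 0 < γ < 1, let π be a policy, and let W : S → ℝ be a terminal value function with 0 ≤ W(s) ≤ V_max for all s. Suppose max_{s,a} D_TV(P(·|s,a), P̂(·|s,a)) ≤ ε_m. For a kernel Q, define the H-step value of π under Q with terminal value W recursively by V_{Q,0} = W and V_{Q,h+1}(s) = Σ_a π(a|s) · (r(s,a) + γ · Σ_{s'} Q(s'|s,a) · V_{Q,h}(s')). Then for every state s and every H ≥ 1, |V_{P,H}(s) − V_{P̂,H}(s)| ≤ R_max · Σ_{t=0}^{H−1} γ^t · t · ε_m + γ^H · H · ε_m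 · V_max. -/
/-- The `H`-step value of a policy `π` under a transition kernel `Q`,
with reward `r`, discount `γ`, and terminal value function `W`:
`V_{Q,0} = W` and
`V_{Q,h+1}(s) = Σ_a π(a|s) (r(s,a) + γ Σ_{s'} Q(s'|s,a) V_{Q,h}(s'))`. -/
def hStepValue {S A : Type*} [Fintype S] [Fintype A]
    (π : S → A → ℝ) (Q : S → A → S → ℝ) (r : S → A → ℝ) (γ : ℝ) (W : S → ℝ) :
    ℕ → S → ℝ
  | 0 => W
  | h + 1 => fun s =>
      ∑ a, π s a * (r s a + γ * ∑ s', Q s a s' * hStepValue π Q r γ W h s')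

theorem aux_avg {X : Type*} [Fintype X] (p f : X → ℝ) (lo hi : ℝ) (hp : ∀ x, 0 ≤ p x)
    (hs : ∑ x, p x = 1) (hf : ∀ x, lo ≤ f x ∧ f x ≤ hi) :
    lo ≤ ∑ x, p x * f x ∧ ∑ x, p x * f x ≤ hi := by
  have h1 : ∑ x, p x * lo = lo := by rw [← Finset.sum_mul, hs, one_mul]
  have h2 : ∑ x, p x * hi = hi := by rw [← Finset.sum_mul, hs, one_mul]
  constructor
  · calc lo = ∑ x, p x * lo := h1.symm
      _ ≤ _ := Finset.sum_le_sum fun x _ => mul_le_mul_of_nonneg_left (hf x).1 (hp x)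
  · calc _ ≤ ∑ x, p x * hi :=
          Finset.sum_le_sum fun x _ => mul_le_mul_of_nonneg_left (hf x).2 (hp x)
      _ = hi := h2

theorem aux_tv {X : Type*} [Fintype X] (p q f : X → ℝ) (B ε : ℝ) (hB : 0 ≤ B)
    (hp : ∑ x, p x = 1) (hq : ∑ x, q x = 1) (hf : ∀ x, 0 ≤ f x ∧ f x ≤ B)
    (h : (1 / 2) * ∑ x, |p x - q x| ≤ ε) :
    |∑ x, p x * f x - ∑ x, q x * f x| ≤ ε * B := by
  have e : ∑ x, p x * f x - ∑ x, q x * f x = ∑ x, (p x - q x) * (f x - B / 2) := by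
    have : ∀ x, (p x - q x) * (f x - B / 2)
        = p x * f x - q x * f x - (p x * (B / 2) - q x * (B / 2)) := fun x => by ring
    simp only [this, Finset.sum_sub_distrib, ← Finset.sum_mul, hp, hq]
    ring
  rw [e]
  calc _ ≤ ∑ x, |(p x - q x) * (f x - B / 2)| := Finset.abs_sum_le_sum_abs _ _
    _ ≤ ∑ x, |p x - q x| * (B / 2) := by
        apply Finset.sum_le_sum
        intro x _
        rw [abs_mul]
        apply mul_le_mul_of_nonneg_left _ (abs_nonneg _)
        have := hf x
        rw [abs_le]
        constructor <;> linarith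
    _ = ((1 / 2) * ∑ x, |p x - q x|) * B := by rw [← Finset.sum_mul]; ring
    _ ≤ ε * B := mul_le_mul_of_nonneg_right h hB

/-- **Model-error bound on `H`-step returns.**
If the two kernels are `ε_m`-close in total variation uniformly over `(s,a)`,
rewards lie in `[0, R_max]`, and the terminal value lies in `[0, V_max]`, then
`|V_{P,H}(s) − V_{P̂,H}(s)| ≤ R_max Σ_{t<H} γ^t t ε_m + γ^H H ε_m V_max`. -/
theorem hStep_model_error_bound
    {S A : Type*} [Fintype S] [Nonempty S] [Fintype A] [Nonempty A]
    -- two transition kernels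
    (P Phat : S → A → S → ℝ)
    (hPnonneg : ∀ s a s', 0 ≤ P s a s') (hPsum : ∀ s a, ∑ s', P s a s' = 1)
    (hPhatnonneg : ∀ s a s', 0 ≤ Phat s a s')
    (hPhatsum : ∀ s a, ∑ s', Phat s a s' = 1)
    -- rewards and discount
    (r : S → A → ℝ) (Rmax : ℝ) (hr : ∀ s a, 0 ≤ r s a ∧ r s a ≤ Rmax)
    (γ : ℝ) (hγ0 : 0 < γ) (hγ1 : γ < 1)
    -- policy
    (π : S → A → ℝ) (hπnonneg : ∀ s a, 0 ≤ π s a) (hπsum : ∀ s, ∑ a, π s a = 1)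
    -- terminal value function
    (W : S → ℝ) (Vmax : ℝ) (hW : ∀ s, 0 ≤ W s ∧ W s ≤ Vmax)
    -- total-variation model error
    (εm : ℝ)
    (hTV : ∀ s a, (1 / 2) * ∑ s', |P s a s' - Phat s a s'| ≤ εm) :
    ∀ (s : S) (H : ℕ), 1 ≤ H →
      |hStepValue π P r γ W H s - hStepValue π Phat r γ W H s|
        ≤ Rmax * (∑ t ∈ Finset.range H, γ ^ t * t * εm)
          + γ ^ H * H * εm * Vmax := by
  have hB : ∀ h s, 0 ≤ hStepValue π P r γ W h s ∧ hStepValue π P r γ W h s ≤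
      Rmax * (∑ t ∈ Finset.range h, γ ^ t) + γ ^ h * Vmax := by
    intro h
    induction h with
    | zero => intro s; simpa [hStepValue] using hW s
    | succ h ih =>
      intro s
      simp only [hStepValue]
      apply aux_avg _ _ _ _ (hπnonneg s) (hπsum s)
      intro a
      have h1 := aux_avg _ _ _ _ (hPnonneg s a) (hPsum s a) ih
      have h2 := hr s a
      have h3 := mul_le_mul_of_nonneg_left h1.2 hγ0.le
      have h4 := mul_nonneg hγ0.le h1.1
      have h5 : ∑ t ∈ Finset.range (h + 1), γ ^ t = γ * (∑ t ∈ Finset.range h, γ ^ t) + 1 := by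
        rw [Finset.sum_range_succ', Finset.mul_sum]
        simp [pow_succ']
      rw [h5, pow_succ']
      constructor
      · linarith
      · linarith
  have key : ∀ (H : ℕ) (s : S),
      |hStepValue π P r γ W H s - hStepValue π Phat r γ W H s|
        ≤ Rmax * (∑ t ∈ Finset.range H, γ ^ t * t * εm)
          + γ ^ H * H * εm * Vmax := by
    intro H
    induction H with
    | zero => intro s; simp [hStepValue]
    | succ h ih =>
      intro s
      have h5 : ∑ t ∈ Finset.range (h + 1), γ ^ t * (t : ℝ) * εm
          = γ * (∑ t ∈ Finset.range h, γ ^ t * t * εm)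
            + γ * εm * (∑ t ∈ Finset.range h, γ ^ t) := by
        rw [Finset.sum_range_succ', Finset.mul_sum, Finset.mul_sum, ← Finset.sum_add_distrib]
        simp only [Nat.cast_zero, mul_zero, zero_mul, add_zero]
        apply Finset.sum_congr rfl
        intro t _
        push_cast
        ring
      have hd : hStepValue π P r γ W (h + 1) s - hStepValue π Phat r γ W (h + 1) s
          = ∑ a, π s a * (γ * ((∑ s', P s a s' * hStepValue π P r γ W h s'
              - ∑ s', Phat s a s' * hStepValue π P r γ W h s')
              + ∑ s', Phat s a s' *
                (hStepValue π P r γ W h s' - hStepValue π Phat r γ W h s'))) := by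
        simp only [hStepValue]
        rw [← Finset.sum_sub_distrib]
        apply Finset.sum_congr rfl
        intro a _
        simp only [mul_sub, Finset.sum_sub_distrib]
        ring
      rw [hd, abs_le]
      apply aux_avg _ _ _ _ (hπnonneg s) (hπsum s)
      intro a
      have h1 := aux_tv (P s a) (Phat s a) _ _ εm ((hB h s).1.trans (hB h s).2)
        (hPsum s a) (hPhatsum s a) (hB h) (hTV s a)
      have h2 := aux_avg _ _ _ _ (hPhatnonneg s a) (hPhatsum s a) (fun s' => abs_le.1 (ih s'))
      have h3 := (abs_add_le _ _).trans (add_le_add h1 (abs_le.2 h2))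
      rw [← abs_le, abs_mul, abs_of_pos hγ0]
      refine (mul_le_mul_of_nonneg_left h3 hγ0.le).trans (le_of_eq ?_)
      rw [h5, pow_succ']
      push_cast
      ring
  exact fun s H _ => key H s
end
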